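/- For n ≥ 2, the cokernel of the ℤ-linear map given by the matrix A_n = [[−E_n, −X_nᵀ],[−X_n, −n·E_{n(n-1)/2}]] is isomorphic to ℤ^(n−1) ⊕ (ℤ/nℤ)^((n−2)(n−3)/2). -/

import Mathlib

open Matrix

/-- Index type for the rows of `X n`: pairs `(i,j)` with `i < j` in `Fin n`. -/
abbrev PairIdx (n : ℕ) := {p : Fin n × Fin n // p.1 < p.2}

/-- The matrix `X n` whose row indexed by `(i,j)` (with `i < j`) is `e i - e j`. -/
def Xmat (n : ℕ) : Matrix (PairIdx n) (Fin n) ℤ :=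
  Matrix.of fun p k => (if k = p.1.1 then 1 else 0) - (if k = p.1.2 then 1 else 0)

/-- The weighted incidence matrix `A n = [[−E, −Xᵀ],[−X, −n·E]]`. -/
def Amat (n : ℕ) : Matrix (Fin n ⊕ PairIdx n) (Fin n ⊕ PairIdx n) ℤ :=
  Matrix.fromBlocks (-1) (-(Xmat n)ᵀ) (-(Xmat n)) (-((n : ℤ) • 1))
/-- The antisymmetric function on ordered pairs extending a function on the pairs `i < j`. -/
def antisymmExt {n : ℕ} (y : PairIdx n → ℤ) (i j : Fin n) : ℤ :=
  if h : i < j then y ⟨(i, j), h⟩ else if h : j < i then -y ⟨(j, i), h⟩ else 0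

lemma antisymmExt_pair {n : ℕ} (y : PairIdx n → ℤ) (p : PairIdx n) :
    antisymmExt y p.1.1 p.1.2 = y p := by
  simp [antisymmExt, p.2]

lemma antisymmExt_swap {n : ℕ} (y : PairIdx n → ℤ) (i j : Fin n) :
    antisymmExt y j i = -antisymmExt y i j := by
  unfold antisymmExt
  rcases lt_trichotomy i j with h | h | h
  · simp [h, h.not_gt]
  · simp [h]
  · simp [h, h.not_gt]

lemma antisymmExt_add {n : ℕ} (y z : PairIdx n → ℤ) (i j : Fin n) :
    antisymmExt (y + z) i j = antisymmExt y i j + antisymmExt z i j := by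
  unfold antisymmExt
  split_ifs <;> simp [add_comm]

lemma antisymmExt_of_antisymm {n : ℕ} {g : Fin n → Fin n → ℤ} (hg : ∀ i j, g j i = -g i j)
    (i j : Fin n) : antisymmExt (fun p => g p.1.1 p.1.2) i j = g i j := by
  unfold antisymmExt
  split_ifs with h₁ h₂
  · rfl
  · simp [hg i j]
  · obtain rfl : i = j := le_antisymm (not_lt.1 h₂) (not_lt.1 h₁)
    have := hg i i
    omega

lemma Xmat_mulVec {n : ℕ} (x : Fin n → ℤ) (p : PairIdx n) :
    (Xmat n *ᵥ x) p = x p.1.1 - x p.1.2 := by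
  simp [Xmat, Matrix.mulVec, dotProduct, sub_mul, Finset.sum_sub_distrib]

lemma Xmat_transpose_mulVec {n : ℕ} (y : PairIdx n → ℤ) (i : Fin n) :
    ((Xmat n)ᵀ *ᵥ y) i = ∑ j, antisymmExt y i j := by
  have key : ((Xmat n)ᵀ *ᵥ y) i = ∑ p : PairIdx n,
      ((if i = p.1.1 then 1 else 0) - (if i = p.1.2 then 1 else 0)) *
        antisymmExt y p.1.1 p.1.2 := by
    simp only [antisymmExt_pair]
    rfl
  rw [key, ← Finset.sum_subtype (Finset.univ.filter fun p : Fin n × Fin n => p.1 < p.2)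
    (by simp) (fun p : Fin n × Fin n =>
      ((if i = p.1 then (1 : ℤ) else 0) - (if i = p.2 then 1 else 0)) * antisymmExt y p.1 p.2),
    Finset.sum_filter, Fintype.sum_prod_type]
  have split : ∀ a b : Fin n, (if a < b then
      ((if i = a then (1 : ℤ) else 0) - (if i = b then 1 else 0)) * antisymmExt y a b else 0)
      = (if i = a then (if a < b then antisymmExt y a b else 0) else 0)
        - (if i = b then (if a < b then antisymmExt y a b else 0) else 0) := by
    intro a b
    split_ifs <;> simp
  simp only [split, Finset.sum_sub_distrib]
  rw [Finset.sum_comm]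
  simp only [Finset.sum_ite_eq, Finset.mem_univ, if_true]
  rw [← Finset.sum_sub_distrib]
  refine Finset.sum_congr rfl fun j _ => ?_
  rcases lt_trichotomy i j with h | h | h
  · simp [h, h.not_gt]
  · simp [h, antisymmExt]
  · simp [h, h.not_gt, antisymmExt_swap y i j]

lemma Amat_mulVec_inl {n : ℕ} (v : Fin n ⊕ PairIdx n → ℤ) (i : Fin n) :
    (Amat n *ᵥ v) (Sum.inl i) =
      -v (Sum.inl i) - ∑ j, antisymmExt (v ∘ Sum.inr) i j := by
  rw [Amat, Matrix.fromBlocks_mulVec]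
  simp [Matrix.neg_mulVec, Xmat_transpose_mulVec, sub_eq_add_neg]

lemma Amat_mulVec_inr {n : ℕ} (v : Fin n ⊕ PairIdx n → ℤ) (p : PairIdx n) :
    (Amat n *ᵥ v) (Sum.inr p) =
      -(v (Sum.inl p.1.1) - v (Sum.inl p.1.2)) - n * v (Sum.inr p) := by
  rw [Amat, Matrix.fromBlocks_mulVec]
  simp [Matrix.neg_mulVec, Xmat_mulVec, sub_eq_add_neg]

/-- The antisymmetric function representing `e - X v` for `z = (v, e)`. -/
def edgeReduction {n : ℕ} (z : Fin n ⊕ PairIdx n → ℤ) (i j : Fin n) : ℤ :=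
  antisymmExt (z ∘ Sum.inr) i j - (z (Sum.inl i) - z (Sum.inl j))

lemma edgeReduction_swap {n : ℕ} (z : Fin n ⊕ PairIdx n → ℤ) (i j : Fin n) :
    edgeReduction z j i = -edgeReduction z i j := by
  unfold edgeReduction
  rw [antisymmExt_swap]
  ring

lemma edgeReduction_add {n : ℕ} (z w : Fin n ⊕ PairIdx n → ℤ) (i j : Fin n) :
    edgeReduction (z + w) i j = edgeReduction z i j + edgeReduction w i j := by
  have h : (z + w) ∘ (Sum.inr : PairIdx n → _) = z ∘ Sum.inr + w ∘ Sum.inr := rfl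
  simp only [edgeReduction, h, antisymmExt_add, Pi.add_apply]
  ring

lemma eq_of_edgeReduction_eq {n : ℕ} {z w : Fin n ⊕ PairIdx n → ℤ}
    (hl : ∀ i, z (Sum.inl i) = w (Sum.inl i))
    (he : ∀ i j, edgeReduction z i j = edgeReduction w i j) : z = w := by
  funext s
  rcases s with i | p
  · exact hl i
  · have := he p.1.1 p.1.2
    simp only [edgeReduction, antisymmExt_pair, hl] at this
    simpa using this

lemma edgeReduction_Amat_mulVec {n : ℕ} (v : Fin n ⊕ PairIdx n → ℤ) (i j : Fin n) :
    edgeReduction (Amat n *ᵥ v) i j = -(n * antisymmExt (v ∘ Sum.inr) i j)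
      + ∑ k, antisymmExt (v ∘ Sum.inr) i k - ∑ k, antisymmExt (v ∘ Sum.inr) j k := by
  have h : (Amat n *ᵥ v) ∘ Sum.inr = fun p : PairIdx n =>
      (fun i j => -(v (Sum.inl i) - v (Sum.inl j)) - n * antisymmExt (v ∘ Sum.inr) i j)
        p.1.1 p.1.2 := by
    funext p
    simp [Amat_mulVec_inr, antisymmExt_pair]
  rw [edgeReduction, h, antisymmExt_of_antisymm (g := fun i j =>
    -(v (Sum.inl i) - v (Sum.inl j)) - n * antisymmExt (v ∘ Sum.inr) i j),
    Amat_mulVec_inl, Amat_mulVec_inl]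
  · ring
  · intro i j
    rw [antisymmExt_swap]
    ring

lemma sum_sum_eq_zero_of_antisymm {n : ℕ} {h : Fin n → Fin n → ℤ} (hh : ∀ i j, h j i = -h i j) :
    ∑ i, ∑ j, h i j = 0 := by
  have h₁ : ∑ i, ∑ j, h i j = -∑ i, ∑ j, h i j := by
    conv_lhs => rw [Finset.sum_comm]
    simp only [← Finset.sum_neg_distrib]
    exact Finset.sum_congr rfl fun i _ => Finset.sum_congr rfl fun j _ => hh i j
  omega

lemma sum_laplacian_eq_zero {n : ℕ} {h : Fin n → Fin n → ℤ} (hh : ∀ i j, h j i = -h i j)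
    (i : Fin n) : ∑ j, (n * h i j - ∑ k, h i k + ∑ k, h j k) = 0 := by
  rw [Finset.sum_add_distrib, Finset.sum_sub_distrib, sum_sum_eq_zero_of_antisymm hh,
    ← Finset.mul_sum]
  simp

/-- The map whose components are the divergences of `e - X v` at the nonzero vertices and its
circulations modulo `n` around the triangles through the vertex `1` avoiding the vertex `0`. -/
def cokerHom (m : ℕ) : (Fin (m + 2) ⊕ PairIdx (m + 2) → ℤ) →+
    (Fin (m + 1) → ℤ) × (PairIdx m → ZMod (m + 2)) where
  toFun z := (fun j => ∑ k, edgeReduction z j.succ k, fun p =>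
    ((edgeReduction z p.1.1.succ.succ p.1.2.succ.succ
      + edgeReduction z p.1.2.succ.succ (Fin.succ 0)
      + edgeReduction z (Fin.succ 0) p.1.1.succ.succ : ℤ) : ZMod (m + 2)))
  map_zero' := by
    have h : ∀ i j, edgeReduction (0 : Fin (m + 2) ⊕ PairIdx (m + 2) → ℤ) i j = 0 := by
      intro i j
      simp [edgeReduction, antisymmExt]
    ext <;> simp [h]
  map_add' z w := by
    ext
    · simp [edgeReduction_add, Finset.sum_add_distrib]
    · simp only [edgeReduction_add, Prod.snd_add, Pi.add_apply]
      push_cast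
      ring

lemma cokerHom_Amat_mulVec (m : ℕ) (v : Fin (m + 2) ⊕ PairIdx (m + 2) → ℤ) :
    cokerHom m (Amat (m + 2) *ᵥ v) = 0 := by
  ext j
  · have h := sum_laplacian_eq_zero (fun i j => antisymmExt_swap (v ∘ Sum.inr) i j) j.succ
    rw [← neg_eq_zero, ← Finset.sum_neg_distrib] at h
    simp only [cokerHom, edgeReduction_Amat_mulVec, AddMonoidHom.coe_mk, ZeroHom.coe_mk]
    refine Eq.trans (Finset.sum_congr rfl fun k _ => ?_) h
    ring
  · have hn : (m : ZMod (m + 2)) + 2 = 0 := by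
      exact_mod_cast ZMod.natCast_self (m + 2)
    simp only [cokerHom, edgeReduction_Amat_mulVec, AddMonoidHom.coe_mk, ZeroHom.coe_mk]
    push_cast
    rw [hn]
    simp

lemma exists_antisymm_laplacian_eq {m : ℕ} {g : Fin (m + 2) → Fin (m + 2) → ℤ}
    (hg : ∀ i j, g j i = -g i j) (hsum : ∀ i : Fin (m + 1), ∑ k, g i.succ k = 0)
    (htri : ∀ i j : Fin m, i < j → ((m + 2 : ℕ) : ℤ) ∣
      g i.succ.succ j.succ.succ + g j.succ.succ (Fin.succ 0) + g (Fin.succ 0) i.succ.succ) :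
    ∃ h : Fin (m + 2) → Fin (m + 2) → ℤ, (∀ i j, h j i = -h i j) ∧
      ∀ i j, ((m + 2 : ℕ) : ℤ) * h i j - ∑ k, h i k + ∑ k, h j k = g i j := by
  have hself : ∀ i, g i i = 0 := fun i => by
    have := hg i i
    omega
  have hdvd : ∀ i j : Fin (m + 1), ((m + 2 : ℕ) : ℤ) ∣
      g i.succ j.succ - g i.succ (Fin.succ 0) + g j.succ (Fin.succ 0) := by
    intro i j
    refine Fin.cases ?_ (fun i => ?_) i
    · rw [hself, hg j.succ (Fin.succ 0)]
      simp
    refine Fin.cases ?_ (fun j => ?_) j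
    · simp [hself]
    rcases lt_trichotomy i j with h | h | h
    · convert htri i j h using 1
      rw [hg i.succ.succ (Fin.succ 0)]
      ring
    · simp [h, hself]
    · obtain ⟨c, hc⟩ := htri j i h
      refine ⟨-c, ?_⟩
      rw [hg i.succ.succ j.succ.succ, hg j.succ.succ (Fin.succ 0)] at hc
      linarith
  choose w hw using hdvd
  have hn : ((m + 2 : ℕ) : ℤ) ≠ 0 := by positivity
  have hwanti : ∀ i j, w j i = -w i j := by
    intro i j
    apply mul_left_cancel₀ hn
    rw [mul_neg, ← hw, ← hw, hg i.succ j.succ]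
    ring
  let t : Fin (m + 1) → ℤ := fun i => g i.succ (Fin.succ 0) + ∑ k, w i k
  let h : Fin (m + 2) → Fin (m + 2) → ℤ := fun i j =>
    Fin.cases (Fin.cases 0 t j) (fun i' => Fin.cases (-t i') (w i') j) i
  have hanti : ∀ i j, h j i = -h i j := by
    intro i j
    refine Fin.cases ?_ (fun i => ?_) i <;> refine Fin.cases ?_ (fun j => ?_) j <;> simp [h]
    exact hwanti i j
  have hS : ∀ i : Fin (m + 1), ∑ k, h i.succ k = -g i.succ (Fin.succ 0) := by
    intro i
    rw [Fin.sum_univ_succ]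
    simp [h, t]
  have hss : ∀ i j : Fin (m + 1), ((m + 2 : ℕ) : ℤ) * h i.succ j.succ - ∑ k, h i.succ k
      + ∑ k, h j.succ k = g i.succ j.succ := by
    intro i j
    rw [hS, hS]
    have : h i.succ j.succ = w i j := rfl
    rw [this, ← hw]
    ring
  have hs0 : ∀ i : Fin (m + 1), ((m + 2 : ℕ) : ℤ) * h i.succ 0 - ∑ k, h i.succ k
      + ∑ k, h 0 k = g i.succ 0 := by
    intro i
    have h₁ := sum_laplacian_eq_zero hanti i.succ
    have h₂ := hsum i
    rw [Fin.sum_univ_succ] at h₁ h₂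
    rw [Finset.sum_congr rfl fun j _ => hss i j] at h₁
    linarith
  refine ⟨h, hanti, fun i j => ?_⟩
  refine Fin.cases ?_ (fun i => ?_) i <;> refine Fin.cases ?_ (fun j => ?_) j
  · rw [hself, show h 0 0 = 0 from rfl]
    ring
  · rw [hg j.succ 0, ← hs0 j, hanti j.succ 0]
    ring
  · exact hs0 i
  · exact hss i j

lemma mem_range_of_cokerHom_eq_zero {m : ℕ} {z : Fin (m + 2) ⊕ PairIdx (m + 2) → ℤ}
    (hz : cokerHom m z = 0) : ∃ v, Amat (m + 2) *ᵥ v = z := by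
  obtain ⟨h, hanti, hh⟩ := exists_antisymm_laplacian_eq (edgeReduction_swap z)
    (fun i => congrFun (congrArg Prod.fst hz) i)
    (fun i j hij => (ZMod.intCast_zmod_eq_zero_iff_dvd _ (m + 2)).1
      (congrFun (congrArg Prod.snd hz) ⟨(i, j), hij⟩))
  have hneg : ∀ i j, -h j i = -(-h i j) := fun i j => by rw [hanti]
  refine ⟨Sum.elim (fun i => -z (Sum.inl i) + ∑ k, h i k) (fun p => -h p.1.1 p.1.2),
    eq_of_edgeReduction_eq (fun i => ?_) (fun i j => ?_)⟩
  · rw [Amat_mulVec_inl, Sum.elim_comp_inr]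
    simp only [antisymmExt_of_antisymm (g := fun i j => -h i j) hneg, Sum.elim_inl,
      Finset.sum_neg_distrib]
    ring
  · rw [edgeReduction_Amat_mulVec, Sum.elim_comp_inr]
    simp only [antisymmExt_of_antisymm (g := fun i j => -h i j) hneg, Finset.sum_neg_distrib]
    rw [← hh]
    ring

lemma cokerHom_surjective (m : ℕ) : Function.Surjective (cokerHom m) := by
  rintro ⟨a, b⟩
  choose c hc using fun p => ZMod.intCast_surjective (b p)
  let w : Fin (m + 1) → Fin (m + 1) → ℤ := fun i j =>
    Fin.cases 0 (fun i' => Fin.cases 0 (antisymmExt c i') j) i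
  have hw : ∀ i j, w j i = -w i j := by
    intro i j
    refine Fin.cases ?_ (fun i => ?_) i <;> refine Fin.cases ?_ (fun j => ?_) j <;> simp [w]
    exact antisymmExt_swap c i j
  let t : Fin (m + 1) → ℤ := fun i => a i - ∑ k, w i k
  let h : Fin (m + 2) → Fin (m + 2) → ℤ := fun i j =>
    Fin.cases (Fin.cases 0 (fun j' => -t j') j) (fun i' => Fin.cases (t i') (w i') j) i
  have hanti : ∀ i j, h j i = -h i j := by
    intro i j
    refine Fin.cases ?_ (fun i => ?_) i <;> refine Fin.cases ?_ (fun j => ?_) j <;> simp [h]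
    exact hw i j
  refine ⟨Sum.elim 0 fun p => h p.1.1 p.1.2, ?_⟩
  have he : ∀ i j, edgeReduction (Sum.elim 0 fun p : PairIdx (m + 2) => h p.1.1 p.1.2) i j
      = h i j := by
    intro i j
    rw [edgeReduction, Sum.elim_comp_inr, antisymmExt_of_antisymm hanti]
    simp
  ext j
  · simp only [cokerHom, AddMonoidHom.coe_mk, ZeroHom.coe_mk, he]
    rw [Fin.sum_univ_succ]
    simp [h, t]
  · have h₁ : ∀ i : Fin m, h i.succ.succ (Fin.succ 0) = 0 := fun _ => rfl
    have h₂ : ∀ i : Fin m, h (Fin.succ 0) i.succ.succ = 0 := fun _ => rfl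
    have h₃ : ∀ i k : Fin m, h i.succ.succ k.succ.succ = antisymmExt c i k := fun _ _ => rfl
    simp only [cokerHom, AddMonoidHom.coe_mk, ZeroHom.coe_mk, he, h₁, h₂, h₃, antisymmExt_pair]
    simp [hc]

lemma card_pairIdx (m : ℕ) : Fintype.card (PairIdx m) = m * (m - 1) / 2 := by
  rw [Fintype.card_subtype, Finset.card_filter, Fintype.sum_prod_type_right]
  simp only [← Finset.card_filter]
  have : ∀ j : Fin m, (Finset.univ.filter fun i => i < j).card = (j : ℕ) := by
    intro j
    rw [Finset.filter_gt_eq_Iio, Fin.card_Iio]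
  simp only [this]
  rw [Fin.sum_univ_eq_sum_range (fun i => i), Finset.sum_range_id]

/-- For `n ≥ 2`, the cokernel of the `ℤ`-linear map given by `A n` is isomorphic to
`ℤ^(n−1) ⊕ (ℤ/nℤ)^((n−2)(n−3)/2)`. -/
theorem stmt7 (n : ℕ) (hn : 2 ≤ n) :
    Nonempty ((((Fin n ⊕ PairIdx n) → ℤ) ⧸ LinearMap.range (Matrix.mulVecLin (Amat n)))
      ≃ₗ[ℤ] (Fin (n - 1) → ℤ) × (Fin ((n - 2) * (n - 3) / 2) → ZMod n)) := by
  obtain ⟨m, rfl⟩ := Nat.exists_eq_add_of_le' hn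
  let φ := (cokerHom m).toIntLinearMap
  have hker : LinearMap.range (Matrix.mulVecLin (Amat (m + 2))) = LinearMap.ker φ := by
    ext z
    constructor
    · rintro ⟨v, rfl⟩
      exact cokerHom_Amat_mulVec m v
    · exact fun hz => mem_range_of_cokerHom_eq_zero hz
  have hcard : Fintype.card (PairIdx m) = (m + 2 - 2) * (m + 2 - 3) / 2 := card_pairIdx m
  exact ⟨(Submodule.quotEquivOfEq _ _ hker).trans <|
    (φ.quotKerEquivOfSurjective (cokerHom_surjective m)).trans <|
      (LinearEquiv.refl ℤ _).prodCongr <|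
        LinearEquiv.funCongrLeft ℤ (ZMod (m + 2)) (Fintype.equivFinOfCardEq hcard).symm⟩
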